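/- Every ontology-mediated instance query q = (O, κ), where O is an LTL_bool^□○ ontology and κ an arbitrary temporal concept, is MSO(<)-rewritable: there is an MSO(<)-formula q(t) with one free first-order variable t such that ans(q, A) = {ℓ ∈ tem(A) : S_A ⊨ q(ℓ)} for every data instance A. -/

import Mathlib

namespace LTLOMQ

/-! ## Temporal concepts (LTL formulas) and their semantics over (ℤ,<) -/

/-- Temporal concepts: arbitrary LTL formulas over atomic concepts indexed by `ℕ`. -/
inductive TC : Type where
  | top : TC
  | atom : ℕ → TC
  | neg : TC → TC
  | and : TC → TC → TC
  | or : TC → TC → TC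
  | nextF : TC → TC
  | diamF : TC → TC
  | boxF : TC → TC
  | untl : TC → TC → TC
  | nextP : TC → TC
  | diamP : TC → TC
  | boxP : TC → TC
  | since : TC → TC → TC

/-- A temporal interpretation assigns to each atomic concept a subset of ℤ. -/
abbrev Itp : Type := ℕ → Set ℤ

/-- The extension of a temporal concept in an interpretation
(strict semantics over `(ℤ,<)`). -/
def TC.sem (M : Itp) : TC → Set ℤ
  | .top => Set.univ
  | .atom a => M a
  | .neg C => (TC.sem M C)ᶜ
  | .and C D => TC.sem M C ∩ TC.sem M D
  | .or C D => TC.sem M C ∪ TC.sem M D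
  | .nextF C => {n | n + 1 ∈ TC.sem M C}
  | .diamF C => {n | ∃ k, n < k ∧ k ∈ TC.sem M C}
  | .boxF C => {n | ∀ k, n < k → k ∈ TC.sem M C}
  | .untl C D => {n | ∃ k, n < k ∧ k ∈ TC.sem M D ∧ ∀ m, n < m → m < k → m ∈ TC.sem M C}
  | .nextP C => {n | n - 1 ∈ TC.sem M C}
  | .diamP C => {n | ∃ k, k < n ∧ k ∈ TC.sem M C}
  | .boxP C => {n | ∀ k, k < n → k ∈ TC.sem M C}
  | .since C D => {n | ∃ k, k < n ∧ k ∈ TC.sem M D ∧ ∀ m, k < m → m < n → m ∈ TC.sem M C}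

/-- Basic temporal concepts: built from atomic concepts using ○F, ○P, □F, □P. -/
inductive TC.IsBasic : TC → Prop
  | atom (a : ℕ) : TC.IsBasic (.atom a)
  | nextF {C : TC} : TC.IsBasic C → TC.IsBasic (.nextF C)
  | nextP {C : TC} : TC.IsBasic C → TC.IsBasic (.nextP C)
  | boxF {C : TC} : TC.IsBasic C → TC.IsBasic (.boxF C)
  | boxP {C : TC} : TC.IsBasic C → TC.IsBasic (.boxP C)

/-- Basic temporal concepts using □F and □P only. -/
inductive TC.IsBasicBox : TC → Prop
  | atom (a : ℕ) : TC.IsBasicBox (.atom a)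
  | boxF {C : TC} : TC.IsBasicBox C → TC.IsBasicBox (.boxF C)
  | boxP {C : TC} : TC.IsBasicBox C → TC.IsBasicBox (.boxP C)

/-- Basic temporal concepts using ○F and ○P only. -/
inductive TC.IsBasicNext : TC → Prop
  | atom (a : ℕ) : TC.IsBasicNext (.atom a)
  | nextF {C : TC} : TC.IsBasicNext C → TC.IsBasicNext (.nextF C)
  | nextP {C : TC} : TC.IsBasicNext C → TC.IsBasicNext (.nextP C)

/-- Positive temporal concepts: no occurrences of ¬. -/
inductive TC.IsPositive : TC → Prop
  | top : TC.IsPositive .top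
  | atom (a : ℕ) : TC.IsPositive (.atom a)
  | and {C D : TC} : TC.IsPositive C → TC.IsPositive D → TC.IsPositive (.and C D)
  | or {C D : TC} : TC.IsPositive C → TC.IsPositive D → TC.IsPositive (.or C D)
  | nextF {C : TC} : TC.IsPositive C → TC.IsPositive (.nextF C)
  | diamF {C : TC} : TC.IsPositive C → TC.IsPositive (.diamF C)
  | boxF {C : TC} : TC.IsPositive C → TC.IsPositive (.boxF C)
  | untl {C D : TC} : TC.IsPositive C → TC.IsPositive D → TC.IsPositive (.untl C D)
  | nextP {C : TC} : TC.IsPositive C → TC.IsPositive (.nextP C)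
  | diamP {C : TC} : TC.IsPositive C → TC.IsPositive (.diamP C)
  | boxP {C : TC} : TC.IsPositive C → TC.IsPositive (.boxP C)
  | since {C D : TC} : TC.IsPositive C → TC.IsPositive D → TC.IsPositive (.since C D)

/-- Prior-LTL formulas: Boolean connectives and □P, ◇P, □F, ◇F only. -/
inductive TC.IsPrior : TC → Prop
  | atom (a : ℕ) : TC.IsPrior (.atom a)
  | neg {C : TC} : TC.IsPrior C → TC.IsPrior (.neg C)
  | and {C D : TC} : TC.IsPrior C → TC.IsPrior D → TC.IsPrior (.and C D)
  | or {C D : TC} : TC.IsPrior C → TC.IsPrior D → TC.IsPrior (.or C D)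
  | boxF {C : TC} : TC.IsPrior C → TC.IsPrior (.boxF C)
  | boxP {C : TC} : TC.IsPrior C → TC.IsPrior (.boxP C)
  | diamF {C : TC} : TC.IsPrior C → TC.IsPrior (.diamF C)
  | diamP {C : TC} : TC.IsPrior C → TC.IsPrior (.diamP C)

/-- Number of occurrences of temporal operators in a temporal concept. -/
def TC.tempOps : TC → ℕ
  | .top => 0
  | .atom _ => 0
  | .neg C => TC.tempOps C
  | .and C D => TC.tempOps C + TC.tempOps D
  | .or C D => TC.tempOps C + TC.tempOps D
  | .nextF C => TC.tempOps C + 1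
  | .diamF C => TC.tempOps C + 1
  | .boxF C => TC.tempOps C + 1
  | .untl C D => TC.tempOps C + TC.tempOps D + 1
  | .nextP C => TC.tempOps C + 1
  | .diamP C => TC.tempOps C + 1
  | .boxP C => TC.tempOps C + 1
  | .since C D => TC.tempOps C + TC.tempOps D + 1

/-- Number of occurrences of symbols in a temporal concept. -/
def TC.size : TC → ℕ
  | .top => 1
  | .atom _ => 1
  | .neg C => TC.size C + 1
  | .and C D => TC.size C + TC.size D + 1
  | .or C D => TC.size C + TC.size D + 1
  | .nextF C => TC.size C + 1
  | .diamF C => TC.size C + 1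
  | .boxF C => TC.size C + 1
  | .untl C D => TC.size C + TC.size D + 1
  | .nextP C => TC.size C + 1
  | .diamP C => TC.size C + 1
  | .boxP C => TC.size C + 1
  | .since C D => TC.size C + TC.size D + 1

/-- The set of subconcepts of a temporal concept. -/
def TC.subs : TC → Set TC
  | .top => {.top}
  | .atom a => {.atom a}
  | .neg C => insert (.neg C) (TC.subs C)
  | .and C D => insert (.and C D) (TC.subs C ∪ TC.subs D)
  | .or C D => insert (.or C D) (TC.subs C ∪ TC.subs D)
  | .nextF C => insert (.nextF C) (TC.subs C)
  | .diamF C => insert (.diamF C) (TC.subs C)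
  | .boxF C => insert (.boxF C) (TC.subs C)
  | .untl C D => insert (.untl C D) (TC.subs C ∪ TC.subs D)
  | .nextP C => insert (.nextP C) (TC.subs C)
  | .diamP C => insert (.diamP C) (TC.subs C)
  | .boxP C => insert (.boxP C) (TC.subs C)
  | .since C D => insert (.since C D) (TC.subs C ∪ TC.subs D)

/-- The set of atomic concepts occurring in a temporal concept. -/
def TC.atoms : TC → Set ℕ
  | .top => ∅
  | .atom a => {a}
  | .neg C => TC.atoms C
  | .and C D => TC.atoms C ∪ TC.atoms D
  | .or C D => TC.atoms C ∪ TC.atoms D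
  | .nextF C => TC.atoms C
  | .diamF C => TC.atoms C
  | .boxF C => TC.atoms C
  | .untl C D => TC.atoms C ∪ TC.atoms D
  | .nextP C => TC.atoms C
  | .diamP C => TC.atoms C
  | .boxP C => TC.atoms C
  | .since C D => TC.atoms C ∪ TC.atoms D

/-! ## Clauses, ontologies, data instances -/

/-- A clause `C₁ ∧ … ∧ C_k → C_{k+1} ∨ … ∨ C_{k+m}`. -/
structure Clause : Type where
  prem : List TC
  concl : List TC

/-- A clause is true in `M` if the intersection of the extensions of the premises
is contained in the union of the extensions of the conclusions. -/
def Clause.holds (M : Itp) (cl : Clause) : Prop :=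
  ∀ n : ℤ, (∀ C ∈ cl.prem, n ∈ TC.sem M C) → ∃ C ∈ cl.concl, n ∈ TC.sem M C

/-- An ontology is a finite set (list) of clauses. -/
abbrev Ontology : Type := List Clause

def Clause.AllBasic (cl : Clause) : Prop :=
  (∀ C ∈ cl.prem, C.IsBasic) ∧ (∀ C ∈ cl.concl, C.IsBasic)

def Clause.AllBasicBox (cl : Clause) : Prop :=
  (∀ C ∈ cl.prem, C.IsBasicBox) ∧ (∀ C ∈ cl.concl, C.IsBasicBox)

def Clause.AllBasicNext (cl : Clause) : Prop :=
  (∀ C ∈ cl.prem, C.IsBasicNext) ∧ (∀ C ∈ cl.concl, C.IsBasicNext)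

/-- Horn: at most one disjunct in the conclusion. -/
def Clause.Horn (cl : Clause) : Prop := cl.concl.length ≤ 1

/-- Krom (binary): at most two concepts altogether. -/
def Clause.Krom (cl : Clause) : Prop := cl.prem.length + cl.concl.length ≤ 2

/-- LTL_bool^□○ ontologies. -/
def Ontology.BoolBoxNext (O : Ontology) : Prop := ∀ cl ∈ O, cl.AllBasic
/-- LTL_bool^□ ontologies. -/
def Ontology.BoolBox (O : Ontology) : Prop := ∀ cl ∈ O, cl.AllBasicBox
/-- LTL_krom^○ ontologies. -/
def Ontology.KromNext (O : Ontology) : Prop := ∀ cl ∈ O, cl.AllBasicNext ∧ cl.Krom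
/-- LTL_krom^□○ ontologies. -/
def Ontology.KromBoxNext (O : Ontology) : Prop := ∀ cl ∈ O, cl.AllBasic ∧ cl.Krom
/-- LTL_horn^□○ ontologies. -/
def Ontology.HornBoxNext (O : Ontology) : Prop := ∀ cl ∈ O, cl.AllBasic ∧ cl.Horn
/-- LTL_horn^□ ontologies. -/
def Ontology.HornBox (O : Ontology) : Prop := ∀ cl ∈ O, cl.AllBasicBox ∧ cl.Horn
/-- LTL_core^□○ ontologies. -/
def Ontology.CoreBoxNext (O : Ontology) : Prop := ∀ cl ∈ O, cl.AllBasic ∧ cl.Horn ∧ cl.Krom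

/-- Number of occurrences of symbols in a clause. -/
def Clause.size (cl : Clause) : ℕ :=
  (cl.prem.map TC.size).sum + (cl.concl.map TC.size).sum + 1

/-- Number of occurrences of symbols in an ontology. -/
def Ontology.size (O : Ontology) : ℕ := (O.map Clause.size).sum

/-- The atomic concept `a` occurs in the ontology `O`. -/
def Ontology.occurs (O : Ontology) (a : ℕ) : Prop :=
  ∃ cl ∈ O, (∃ C ∈ cl.prem, a ∈ C.atoms) ∨ (∃ C ∈ cl.concl, a ∈ C.atoms)

/-- The set of subconcepts of (concepts occurring in) an ontology. -/
def Ontology.subs (O : Ontology) : Set TC :=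
  {C | ∃ cl ∈ O, ∃ D : TC, (D ∈ cl.prem ∨ D ∈ cl.concl) ∧ C ∈ D.subs}

/-- A flat concept: an atomic concept, or a single ○F or ○P applied to an atomic concept. -/
def TC.IsFlat : TC → Prop
  | .atom _ => True
  | .nextF (.atom _) => True
  | .nextP (.atom _) => True
  | _ => False

/-- An ontology without nested temporal operators. -/
def Ontology.Flat (O : Ontology) : Prop :=
  ∀ cl ∈ O, (∀ C ∈ cl.prem, C.IsFlat) ∧ (∀ C ∈ cl.concl, C.IsFlat)

/-- A data instance: a finite nonempty set of timestamped atoms, normalized so that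
the minimal timestamp is 0 and the maximal one is ≥ 1. -/
structure DataInstance : Type where
  atoms : Finset (ℕ × ℤ)
  nonneg : ∀ p ∈ atoms, 0 ≤ p.2
  has_zero : ∃ p ∈ atoms, p.2 = 0
  has_one : ∃ p ∈ atoms, 1 ≤ p.2

theorem DataInstance.ts_nonempty (A : DataInstance) :
    (A.atoms.image Prod.snd).Nonempty := by
  obtain ⟨p, hp, -⟩ := A.has_zero
  exact ⟨p.2, Finset.mem_image_of_mem _ hp⟩

/-- min A: the minimal timestamp occurring in the data instance (equal to 0). -/
def DataInstance.minT (A : DataInstance) : ℤ :=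
  (A.atoms.image Prod.snd).min' A.ts_nonempty

/-- max A: the maximal timestamp occurring in the data instance. -/
def DataInstance.maxT (A : DataInstance) : ℤ :=
  (A.atoms.image Prod.snd).max' A.ts_nonempty

/-- The active temporal domain tem(A). -/
def DataInstance.tem (A : DataInstance) : Set ℤ := Set.Icc A.minT A.maxT

/-- The interpretation of atomic concepts in the first-order structure S_A. -/
def DataInstance.itp (A : DataInstance) : Itp := fun a => {n | (a, n) ∈ A.atoms}

/-- `M` is a model of the knowledge base `(O, A)`. -/
def IsModel (M : Itp) (O : Ontology) (A : DataInstance) : Prop :=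
  (∀ cl ∈ O, cl.holds M) ∧ ∀ p ∈ A.atoms, p.2 ∈ M p.1

/-- The ontology `O` is consistent. -/
def Ontology.Consistent (O : Ontology) : Prop := ∃ M : Itp, ∀ cl ∈ O, cl.holds M

/-- The data instance `A` is consistent with `O`. -/
def ConsistentWith (O : Ontology) (A : DataInstance) : Prop := ∃ M : Itp, IsModel M O A

/-- Certain answers to the OMIQ `(O, κ)` over `A` (within the active domain). -/
def certAns (O : Ontology) (κ : TC) (A : DataInstance) : Set ℤ :=
  {ℓ | ℓ ∈ A.tem ∧ ∀ M : Itp, IsModel M O A → ℓ ∈ TC.sem M κ}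

/-- Certain answers to the OMIQ `(O, κ)` over `A` and ℤ. -/
def certAnsZ (O : Ontology) (κ : TC) (A : DataInstance) : Set ℤ :=
  {ℓ | ∀ M : Itp, IsModel M O A → ℓ ∈ TC.sem M κ}

/-! ## First-order, MSO and FO(RPR) formulas over the temporal structures -/

/-- Formulas of the target languages: first-order variables are indexed by `ℕ`,
as are second-order (set) variables and the recursively defined relation variables
of FO(RPR).  The constructors `qprev j` and `qapp j x` stand for `Q_j(t-1)` (inside
a recursive definition block) and `Q_j(x)`, respectively; `rpr n Θ tv ψ` is the
relational-primitive-recursion construct `[Q₁(t) ≡ Θ₁; …; Q_n(t) ≡ Θ_n] ψ`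
with recursion variable `tv`. -/
inductive Fml : Type where
  | falsum : Fml
  | atom : ℕ → ℕ → Fml        -- A(x)
  | lt : ℕ → ℕ → Fml          -- x < y
  | eq : ℕ → ℕ → Fml          -- x = y
  | succ : ℕ → ℕ → Fml        -- x = y + 1
  | mod : ℕ → ℕ → Fml         -- x ≡ 0 (mod n)
  | svar : ℕ → ℕ → Fml        -- X(x), X a set variable
  | qprev : ℕ → Fml           -- Q_j(t−1)
  | qapp : ℕ → ℕ → Fml        -- Q_j(x)
  | neg : Fml → Fml
  | and : Fml → Fml → Fml
  | or : Fml → Fml → Fml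
  | ex : ℕ → Fml → Fml
  | all : ℕ → Fml → Fml
  | exS : ℕ → Fml → Fml       -- second-order ∃
  | allS : ℕ → Fml → Fml      -- second-order ∀
  | rpr : (n : ℕ) → (Fin n → Fml) → ℕ → Fml → Fml

/-- Evaluation of a formula over the structure with (active) domain `D ⊆ ℤ`
and interpretation `I` of the unary predicates; `env` assigns first-order
variables, `senv` set variables, `prev` the placeholders `Q_j(t-1)` and
`Q` the defined relation variables. First-order quantifiers range over `D`,
second-order quantifiers over subsets of `D`. -/
def Fml.eval (D : Set ℤ) (I : ℕ → Set ℤ) :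
    Fml → (ℕ → ℤ) → (ℕ → Set ℤ) → (ℕ → Prop) → (ℕ → ℤ → Prop) → Prop
  | .falsum, _, _, _, _ => False
  | .atom a x, env, _, _, _ => env x ∈ I a
  | .lt x y, env, _, _, _ => env x < env y
  | .eq x y, env, _, _, _ => env x = env y
  | .succ x y, env, _, _, _ => env x = env y + 1
  | .mod n x, env, _, _, _ => (n : ℤ) ∣ env x
  | .svar X x, env, senv, _, _ => env x ∈ senv X
  | .qprev j, _, _, prev, _ => prev j
  | .qapp j x, env, _, _, Q => Q j (env x)
  | .neg φ, env, senv, prev, Q => ¬ Fml.eval D I φ env senv prev Q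
  | .and φ ψ, env, senv, prev, Q =>
      Fml.eval D I φ env senv prev Q ∧ Fml.eval D I ψ env senv prev Q
  | .or φ ψ, env, senv, prev, Q =>
      Fml.eval D I φ env senv prev Q ∨ Fml.eval D I ψ env senv prev Q
  | .ex x φ, env, senv, prev, Q =>
      ∃ d ∈ D, Fml.eval D I φ (Function.update env x d) senv prev Q
  | .all x φ, env, senv, prev, Q =>
      ∀ d ∈ D, Fml.eval D I φ (Function.update env x d) senv prev Q
  | .exS X φ, env, senv, prev, Q =>
      ∃ S : Set ℤ, S ⊆ D ∧ Fml.eval D I φ env (Function.update senv X S) prev Q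
  | .allS X φ, env, senv, prev, Q =>
      ∀ S : Set ℤ, S ⊆ D → Fml.eval D I φ env (Function.update senv X S) prev Q
  | .rpr n Θ tv ψ, env, senv, prev, Q =>
      -- the semantics of each Θ_j, as a function of the first-order environment
      -- and of the truth values of the `Q_j(t−1)` placeholders
      let f : Fin n → (ℕ → ℤ) → (ℕ → Prop) → Prop :=
        fun j env' prev' => Fml.eval D I (Θ j) env' senv prev' Q
      -- the recursively computed truth values of `Q_j` at time `k` (recursion on k from 0)
      let recQ : ℕ → Fin n → Prop := fun k =>
        Nat.rec (fun j => f j (Function.update env tv 0) (fun _ => False))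
          (fun m ih j => f j (Function.update env tv ((m : ℤ) + 1))
            (fun i => ∃ h : i < n, ih ⟨i, h⟩)) k
      Fml.eval D I ψ env senv prev
        (fun j z => ∃ h : j < n, 0 ≤ z ∧ recQ z.toNat ⟨j, h⟩)

/-- Free first-order variables of a formula. -/
def Fml.fvars : Fml → Set ℕ
  | .falsum => ∅
  | .atom _ x => {x}
  | .lt x y => {x, y}
  | .eq x y => {x, y}
  | .succ x y => {x, y}
  | .mod _ x => {x}
  | .svar _ x => {x}
  | .qprev _ => ∅
  | .qapp _ x => {x}
  | .neg φ => Fml.fvars φ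
  | .and φ ψ => Fml.fvars φ ∪ Fml.fvars ψ
  | .or φ ψ => Fml.fvars φ ∪ Fml.fvars ψ
  | .ex x φ => Fml.fvars φ \ {x}
  | .all x φ => Fml.fvars φ \ {x}
  | .exS _ φ => Fml.fvars φ
  | .allS _ φ => Fml.fvars φ
  | .rpr n Θ tv ψ => (⋃ j : Fin n, Fml.fvars (Θ j) \ {tv}) ∪ Fml.fvars ψ

/-- FO(<)-formulas: first-order logic with the built-in linear order
(and the definable equality predicate); no constants, no arithmetic. -/
def Fml.IsFOlt : Fml → Prop
  | .falsum => True
  | .atom _ _ => True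
  | .lt _ _ => True
  | .eq _ _ => True
  | .neg φ => Fml.IsFOlt φ
  | .and φ ψ => Fml.IsFOlt φ ∧ Fml.IsFOlt ψ
  | .or φ ψ => Fml.IsFOlt φ ∧ Fml.IsFOlt ψ
  | .ex _ φ => Fml.IsFOlt φ
  | .all _ φ => Fml.IsFOlt φ
  | _ => False

/-- FO(<,≡)-formulas: FO(<) extended with the predicates `t ≡ 0 (mod n)`, `n > 1`. -/
def Fml.IsFOltMod : Fml → Prop
  | .falsum => True
  | .atom _ _ => True
  | .lt _ _ => True
  | .eq _ _ => True
  | .mod n _ => 2 ≤ n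
  | .neg φ => Fml.IsFOltMod φ
  | .and φ ψ => Fml.IsFOltMod φ ∧ Fml.IsFOltMod ψ
  | .or φ ψ => Fml.IsFOltMod φ ∧ Fml.IsFOltMod ψ
  | .ex _ φ => Fml.IsFOltMod φ
  | .all _ φ => Fml.IsFOltMod φ
  | _ => False

/-- MSO(<)-formulas: FO(<) extended with set variables and second-order quantifiers. -/
def Fml.IsMSO : Fml → Prop
  | .falsum => True
  | .atom _ _ => True
  | .lt _ _ => True
  | .eq _ _ => True
  | .svar _ _ => True
  | .neg φ => Fml.IsMSO φ
  | .and φ ψ => Fml.IsMSO φ ∧ Fml.IsMSO ψ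
  | .or φ ψ => Fml.IsMSO φ ∧ Fml.IsMSO ψ
  | .ex _ φ => Fml.IsMSO φ
  | .all _ φ => Fml.IsMSO φ
  | .exS _ φ => Fml.IsMSO φ
  | .allS _ φ => Fml.IsMSO φ
  | _ => False

/-- FO(RPR)-formulas: FO(<) extended with successor and relational primitive recursion. -/
def Fml.IsRPR : Fml → Prop
  | .falsum => True
  | .atom _ _ => True
  | .lt _ _ => True
  | .eq _ _ => True
  | .succ _ _ => True
  | .qprev _ => True
  | .qapp _ _ => True
  | .neg φ => Fml.IsRPR φ
  | .and φ ψ => Fml.IsRPR φ ∧ Fml.IsRPR ψ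
  | .or φ ψ => Fml.IsRPR φ ∧ Fml.IsRPR ψ
  | .ex _ φ => Fml.IsRPR φ
  | .all _ φ => Fml.IsRPR φ
  | .rpr n Θ _ ψ => (∀ j : Fin n, Fml.IsRPR (Θ j)) ∧ Fml.IsRPR ψ
  | _ => False

/-- MFO(<)-formulas: monadic first-order formulas built from atoms `A(t)`,
`t < t'`, `t = t'` and `t = t' + 1`. -/
def Fml.IsMFO : Fml → Prop
  | .falsum => True
  | .atom _ _ => True
  | .lt _ _ => True
  | .eq _ _ => True
  | .succ _ _ => True
  | .neg φ => Fml.IsMFO φ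
  | .and φ ψ => Fml.IsMFO φ ∧ Fml.IsMFO ψ
  | .or φ ψ => Fml.IsMFO φ ∧ Fml.IsMFO ψ
  | .ex _ φ => Fml.IsMFO φ
  | .all _ φ => Fml.IsMFO φ
  | _ => False

/-- Quasi-positive MFO(<)-formulas: built from atoms `A(t)`, `t < t'`, `t = t'`,
`t = t' + 1` (and ⊥) using ∧, ∨, ∃, ∀ as well as guarded universal quantification
`∀y (x < y < z → φ)`, `∀y (x < y → φ)`, `∀y (y < z → φ)`
(the guarded implications are encoded via `¬guard ∨ φ`). -/
inductive Fml.IsQP : Fml → Prop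
  | falsum : Fml.IsQP .falsum
  | atom (a x : ℕ) : Fml.IsQP (.atom a x)
  | lt (x y : ℕ) : Fml.IsQP (.lt x y)
  | eq (x y : ℕ) : Fml.IsQP (.eq x y)
  | succ (x y : ℕ) : Fml.IsQP (.succ x y)
  | and {φ ψ : Fml} : Fml.IsQP φ → Fml.IsQP ψ → Fml.IsQP (.and φ ψ)
  | or {φ ψ : Fml} : Fml.IsQP φ → Fml.IsQP ψ → Fml.IsQP (.or φ ψ)
  | ex (x : ℕ) {φ : Fml} : Fml.IsQP φ → Fml.IsQP (.ex x φ)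
  | all (x : ℕ) {φ : Fml} : Fml.IsQP φ → Fml.IsQP (.all x φ)
  | allBtw (y x z : ℕ) {φ : Fml} : Fml.IsQP φ →
      Fml.IsQP (.all y (.or (.neg (.and (.lt x y) (.lt y z))) φ))
  | allGt (y x : ℕ) {φ : Fml} : Fml.IsQP φ →
      Fml.IsQP (.all y (.or (.neg (.lt x y)) φ))
  | allLt (y z : ℕ) {φ : Fml} : Fml.IsQP φ →
      Fml.IsQP (.all y (.or (.neg (.lt y z)) φ))

/-- Evaluation in a structure with domain `D` and unary predicates `I`
(no set variables, placeholders or relation variables supplied). -/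
def Fml.evalIn (D : Set ℤ) (I : Itp) (φ : Fml) (env : ℕ → ℤ) : Prop :=
  Fml.eval D I φ env (fun _ => ∅) (fun _ => False) (fun _ _ => False)

/-- An MFO(<)-formula is monotone if it is preserved under adding time points
to the extensions of the atomic concepts. -/
def MonotoneFml (ψ : Fml) : Prop :=
  ∀ M₁ M₂ : Itp, (∀ a : ℕ, M₁ a ⊆ M₂ a) → ∀ env : ℕ → ℤ,
    Fml.evalIn Set.univ M₁ ψ env → Fml.evalIn Set.univ M₂ ψ env

/-! ## The canonical model of a Horn ontology and a data instance -/

/-- Atoms of the closure: ⊥ or `C(n)` for a (basic) temporal concept `C` and `n ∈ ℤ`. -/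
inductive EAtom : Type where
  | bot : EAtom
  | conc : TC → ℤ → EAtom

/-- One (non-recursive) application of the closure rules of the canonical model. -/
def clStep (O : Ontology) (Λ : Set EAtom) : Set EAtom :=
  Λ ∪
  {e | ∃ cl ∈ O, ∃ n : ℤ, (∀ C ∈ cl.prem, EAtom.conc C n ∈ Λ) ∧
        ((∃ C : TC, cl.concl = [C] ∧ e = EAtom.conc C n) ∨
          (cl.concl = [] ∧ e = EAtom.bot))} ∪
  {e | ∃ C : TC, ∃ n k : ℤ, n < k ∧ EAtom.conc (.boxF C) n ∈ Λ ∧ e = EAtom.conc C k} ∪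
  {e | ∃ C : TC, ∃ n : ℤ, (∀ k : ℤ, n < k → EAtom.conc C k ∈ Λ) ∧
        e = EAtom.conc (.boxF C) n} ∪
  {e | ∃ C : TC, ∃ n : ℤ, EAtom.conc (.nextF C) n ∈ Λ ∧ e = EAtom.conc C (n + 1)} ∪
  {e | ∃ C : TC, ∃ n : ℤ, EAtom.conc C (n + 1) ∈ Λ ∧ e = EAtom.conc (.nextF C) n} ∪
  {e | ∃ C : TC, ∃ n k : ℤ, k < n ∧ EAtom.conc (.boxP C) n ∈ Λ ∧ e = EAtom.conc C k} ∪
  {e | ∃ C : TC, ∃ n : ℤ, (∀ k : ℤ, k < n → EAtom.conc C k ∈ Λ) ∧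
        e = EAtom.conc (.boxP C) n} ∪
  {e | ∃ C : TC, ∃ n : ℤ, EAtom.conc (.nextP C) n ∈ Λ ∧ e = EAtom.conc C (n - 1)} ∪
  {e | ∃ C : TC, ∃ n : ℤ, EAtom.conc C (n - 1) ∈ Λ ∧ e = EAtom.conc (.nextP C) n}

/-- Transfinite iteration of the closure rules. -/
noncomputable def clIter (O : Ontology) (Λ : Set EAtom) (o : Ordinal.{0}) : Set EAtom :=
  Ordinal.limitRecOn o Λ (fun _ ih => clStep O ih)
    (fun o _ ih => ⋃ (o' : Ordinal.{0}), ⋃ (h : o' < o), ih o' h)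

/-- The atoms of a data instance, as a set of closure atoms. -/
def dataAtoms (A : DataInstance) : Set EAtom :=
  {e | ∃ p ∈ A.atoms, e = EAtom.conc (.atom p.1) p.2}

open Ordinal in
/-- The canonical model `C_{O,A}`: the closure of `A` under the rules,
iterated up to the first uncountable ordinal ω₁. -/
noncomputable def canon (O : Ontology) (A : DataInstance) : Set EAtom :=
  clIter O (dataAtoms A) (Ordinal.omega 1)

/-- The canonical model regarded as a temporal interpretation. -/
noncomputable def canonItp (O : Ontology) (A : DataInstance) : Itp :=
  fun a => {n | EAtom.conc (.atom a) n ∈ canon O A}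

/-- The type `τ_{O,A}(n)`: the set of subconcepts of `O` that hold at `n`
in the canonical model. -/
noncomputable def tau (O : Ontology) (A : DataInstance) (n : ℤ) : Set TC :=
  {C ∈ O.subs | n ∈ TC.sem (canonItp O A) C}

/-! ## Literals and the reachability relation ⇝ for Krom ontologies -/

/-- A simple literal: an atomic concept with a polarity. -/
abbrev Lit : Type := ℕ × Bool

/-- The temporal concept corresponding to a literal. -/
def Lit.toTC (L : Lit) : TC := if L.2 then .atom L.1 else .neg (.atom L.1)

def TC.iterF : ℕ → TC → TC
  | 0, C => C
  | k + 1, C => .nextF (TC.iterF k C)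

def TC.iterP : ℕ → TC → TC
  | 0, C => C
  | k + 1, C => .nextP (TC.iterP k C)

/-- `○^k C`: `k` occurrences of ○F if `k > 0`, of ○P if `k < 0`. -/
def TC.shift (k : ℤ) (C : TC) : TC :=
  if 0 ≤ k then TC.iterF k.toNat C else TC.iterP (-k).toNat C

/-- `(L₁,n₁) ⇝ (L₂,n₂)`: in every model of `O`,
`(○^{n₁} L₁)^M ⊆ (○^{n₂} L₂)^M`. -/
def leadsTo (O : Ontology) (L₁ : Lit) (n₁ : ℤ) (L₂ : Lit) (n₂ : ℤ) : Prop :=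
  ∀ M : Itp, (∀ cl ∈ O, cl.holds M) →
    TC.sem M (TC.shift n₁ L₁.toTC) ⊆ TC.sem M (TC.shift n₂ L₂.toTC)


/-! ## Unfolding laws, translations and gluing of temporal interpretations -/

theorem TC.mem_sem_diamF_iff (M : Itp) (C : TC) (n : ℤ) :
    n ∈ TC.sem M (.diamF C) ↔ n + 1 ∈ TC.sem M C ∨ n + 1 ∈ TC.sem M (.diamF C) := by
  simp only [TC.sem, Set.mem_ofPred_eq]
  constructor
  · rintro ⟨k, hk, h⟩
    rcases eq_or_lt_of_le (Int.add_one_le_of_lt hk) with rfl | h'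
    exacts [.inl h, .inr ⟨k, h', h⟩]
  · rintro (h | ⟨k, hk, h⟩)
    exacts [⟨n + 1, by omega, h⟩, ⟨k, by omega, h⟩]

theorem TC.mem_sem_boxF_iff (M : Itp) (C : TC) (n : ℤ) :
    n ∈ TC.sem M (.boxF C) ↔ n + 1 ∈ TC.sem M C ∧ n + 1 ∈ TC.sem M (.boxF C) := by
  simp only [TC.sem, Set.mem_ofPred_eq]
  constructor
  · exact fun h => ⟨h _ (by omega), fun k hk => h k (by omega)⟩
  · rintro ⟨h, h'⟩ k hk
    rcases eq_or_lt_of_le (Int.add_one_le_of_lt hk) with rfl | hk'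
    exacts [h, h' k hk']

theorem TC.mem_sem_untl_iff (M : Itp) (C D : TC) (n : ℤ) :
    n ∈ TC.sem M (.untl C D) ↔
      n + 1 ∈ TC.sem M D ∨ (n + 1 ∈ TC.sem M C ∧ n + 1 ∈ TC.sem M (.untl C D)) := by
  simp only [TC.sem, Set.mem_ofPred_eq]
  constructor
  · rintro ⟨k, hk, h, hC⟩
    rcases eq_or_lt_of_le (Int.add_one_le_of_lt hk) with rfl | hk'
    · exact .inl h
    · exact .inr ⟨hC _ (by omega) hk', k, hk', h, fun m hm => hC m (by omega)⟩
  · rintro (h | ⟨hC, k, hk, h, hC'⟩)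
    · exact ⟨n + 1, by omega, h, fun m _ _ => by omega⟩
    · refine ⟨k, by omega, h, fun m hm hmk => ?_⟩
      rcases eq_or_lt_of_le (Int.add_one_le_of_lt hm) with rfl | hm'
      exacts [hC, hC' m hm' hmk]

theorem TC.mem_sem_diamP_iff (M : Itp) (C : TC) (n : ℤ) :
    n + 1 ∈ TC.sem M (.diamP C) ↔ n ∈ TC.sem M C ∨ n ∈ TC.sem M (.diamP C) := by
  simp only [TC.sem, Set.mem_ofPred_eq]
  constructor
  · rintro ⟨k, hk, h⟩
    rcases eq_or_lt_of_le (Int.le_of_lt_add_one hk) with rfl | h'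
    exacts [.inl h, .inr ⟨k, h', h⟩]
  · rintro (h | ⟨k, hk, h⟩)
    exacts [⟨n, by omega, h⟩, ⟨k, by omega, h⟩]

theorem TC.mem_sem_boxP_iff (M : Itp) (C : TC) (n : ℤ) :
    n + 1 ∈ TC.sem M (.boxP C) ↔ n ∈ TC.sem M C ∧ n ∈ TC.sem M (.boxP C) := by
  simp only [TC.sem, Set.mem_ofPred_eq]
  constructor
  · exact fun h => ⟨h _ (by omega), fun k hk => h k (by omega)⟩
  · rintro ⟨h, h'⟩ k hk
    rcases eq_or_lt_of_le (Int.le_of_lt_add_one hk) with rfl | hk'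
    exacts [h, h' k hk']

theorem TC.mem_sem_since_iff (M : Itp) (C D : TC) (n : ℤ) :
    n + 1 ∈ TC.sem M (.since C D) ↔
      n ∈ TC.sem M D ∨ (n ∈ TC.sem M C ∧ n ∈ TC.sem M (.since C D)) := by
  simp only [TC.sem, Set.mem_ofPred_eq]
  constructor
  · rintro ⟨k, hk, h, hC⟩
    rcases eq_or_lt_of_le (Int.le_of_lt_add_one hk) with rfl | hk'
    · exact .inl h
    · exact .inr ⟨hC _ hk' (by omega), k, hk', h, fun m hm hmn => hC m hm (by omega)⟩
  · rintro (h | ⟨hC, k, hk, h, hC'⟩)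
    · exact ⟨n, by omega, h, fun m _ _ => by omega⟩
    · refine ⟨k, by omega, h, fun m hm hmn => ?_⟩
      rcases eq_or_lt_of_le (Int.le_of_lt_add_one hmn) with rfl | hm'
      exacts [hC, hC' m hm hm']

/-- The translate of an interpretation. -/
def Itp.translate (M : Itp) (k : ℤ) : Itp := fun a => {n | n + k ∈ M a}

theorem TC.mem_sem_translate (M : Itp) (k : ℤ) (C : TC) (n : ℤ) :
    n ∈ TC.sem (M.translate k) C ↔ n + k ∈ TC.sem M C := by
  induction C generalizing n with
  | top => simp [TC.sem]
  | atom a => simp [TC.sem, Itp.translate]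
  | neg C ih => simp [TC.sem, ih]
  | and C D ihC ihD => simp [TC.sem, ihC, ihD]
  | or C D ihC ihD => simp [TC.sem, ihC, ihD]
  | nextF C ih => simp only [TC.sem, Set.mem_ofPred_eq, ih, add_right_comm]
  | nextP C ih => simp only [TC.sem, Set.mem_ofPred_eq, ih, sub_add_eq_add_sub]
  | diamF C ih | diamP C ih =>
    simp only [TC.sem, Set.mem_ofPred_eq, ih]
    refine Iff.trans ?_ (Equiv.addRight k).surjective.exists.symm
    simp
  | boxF C ih | boxP C ih =>
    simp only [TC.sem, Set.mem_ofPred_eq, ih]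
    refine Iff.trans ?_ (Equiv.addRight k).surjective.forall.symm
    simp
  | untl C D ihC ihD | since C D ihC ihD =>
    simp only [TC.sem, Set.mem_ofPred_eq, ihC, ihD]
    refine Iff.trans ?_ (Equiv.addRight k).surjective.exists.symm
    refine exists_congr fun j => and_congr (by simp) (and_congr Iff.rfl ?_)
    refine Iff.trans ?_ (Equiv.addRight k).surjective.forall.symm
    simp

theorem Clause.holds_translate {M : Itp} {cl : Clause} (h : cl.holds M) (k : ℤ) :
    cl.holds (M.translate k) := by
  intro n hn
  simp only [TC.mem_sem_translate] at hn ⊢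
  exact h _ hn

theorem TC.mem_subs_self (C : TC) : C ∈ C.subs := by
  cases C <;> simp [TC.subs]

theorem TC.subs_finite (C : TC) : C.subs.Finite := by
  induction C <;> simp_all [TC.subs]

theorem Ontology.subs_finite (O : Ontology) : O.subs.Finite := by
  have : O.subs = ⋃ cl ∈ {cl | cl ∈ O}, ⋃ D ∈ {D | D ∈ cl.prem ++ cl.concl}, D.subs := by
    ext C
    simp [Ontology.subs]
  rw [this]
  exact (List.finite_toSet O).biUnion fun cl _ =>
    (List.finite_toSet _).biUnion fun D _ => D.subs_finite

theorem iff_of_iff_succ {p q : ℤ → Prop} {b : ℤ} (hb : ∀ n, b ≤ n → (p n ↔ q n))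
    (hs : ∀ n, (p (n + 1) ↔ q (n + 1)) → (p n ↔ q n)) (n : ℤ) : p n ↔ q n := by
  rcases le_total b n with h | h
  · exact hb n h
  · induction n, h using Int.leInductionDown with
    | base => exact hb b le_rfl
    | pred n _ ih => exact hs _ (by simpa using ih)

theorem iff_of_iff_pred {p q : ℤ → Prop} {a : ℤ} (ha : ∀ n, n ≤ a → (p n ↔ q n))
    (hs : ∀ n, (p n ↔ q n) → (p (n + 1) ↔ q (n + 1))) (n : ℤ) : p n ↔ q n := by
  rcases le_total n a with h | h
  · exact ha n h
  · induction n, h using Int.leInduction with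
    | base => exact ha a le_rfl
    | succ n _ ih => exact hs _ ih

/-- A labelling of `ℤ` by types that agrees with an interpretation on a left and on a right
ray, and each of whose consecutive pairs of types is realised, is the labelling by the types
of some interpretation. -/
theorem TC.mem_sem_glue {S : Set TC} {ρ : ℤ → TC → Prop} {a b : ℤ} {M₁ M₂ : Itp}
    (hl : ∀ n ≤ a, ∀ C ∈ S, (ρ n C ↔ n ∈ TC.sem M₁ C))
    (hr : ∀ n, b ≤ n → ∀ C ∈ S, (ρ n C ↔ n ∈ TC.sem M₂ C))
    (hs : ∀ n, ∃ M : Itp, ∀ C ∈ S,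
      (ρ n C ↔ n ∈ TC.sem M C) ∧ (ρ (n + 1) C ↔ n + 1 ∈ TC.sem M C))
    (C : TC) (hC : C.subs ⊆ S) (n : ℤ) :
    n ∈ TC.sem (fun x => {n | TC.atom x ∈ S → ρ n (.atom x)}) C ↔ ρ n C := by
  set M : Itp := fun x => {n | TC.atom x ∈ S → ρ n (.atom x)} with hM
  induction C generalizing n with
  | top =>
    obtain ⟨N, hN⟩ := hs n
    simp [(hN _ (hC (TC.mem_subs_self _))).1, TC.sem]
  | atom x =>
    have := hC (TC.mem_subs_self _)
    simp [TC.sem, hM, this]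
  | neg C ih =>
    obtain ⟨N, hN⟩ := hs n
    simp only [TC.subs, Set.insert_subset_iff] at hC
    rw [(hN _ hC.1).1]
    simp [TC.sem, ih hC.2, (hN _ (hC.2 (TC.mem_subs_self _))).1]
  | and C D ihC ihD | or C D ihC ihD =>
    obtain ⟨N, hN⟩ := hs n
    simp only [TC.subs, Set.insert_subset_iff, Set.union_subset_iff] at hC
    rw [(hN _ hC.1).1]
    simp [TC.sem, ihC hC.2.1, ihD hC.2.2, (hN _ (hC.2.1 (TC.mem_subs_self _))).1,
      (hN _ (hC.2.2 (TC.mem_subs_self _))).1]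
  | nextF C ih =>
    obtain ⟨N, hN⟩ := hs n
    simp only [TC.subs, Set.insert_subset_iff] at hC
    rw [(hN _ hC.1).1]
    simp [TC.sem, ih hC.2, (hN _ (hC.2 (TC.mem_subs_self _))).2]
  | nextP C ih =>
    obtain ⟨n, rfl⟩ : ∃ m, n = m + 1 := ⟨n - 1, by omega⟩
    obtain ⟨N, hN⟩ := hs n
    simp only [TC.subs, Set.insert_subset_iff] at hC
    rw [(hN _ hC.1).2]
    simp [TC.sem, ih hC.2, (hN _ (hC.2 (TC.mem_subs_self _))).1]
  | diamF C ih =>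
    simp only [TC.subs, Set.insert_subset_iff] at hC
    have hC' := hC.2 (TC.mem_subs_self _)
    refine iff_of_iff_succ (p := (· ∈ TC.sem M (.diamF C))) (q := (ρ · (.diamF C)))
      (b := b) (fun n hn => ?_) (fun n hn => ?_) n
    · rw [hr n hn _ hC.1]
      simp only [TC.sem, Set.mem_ofPred_eq, ih hC.2]
      grind
    · obtain ⟨N, hN⟩ := hs n
      grind [TC.mem_sem_diamF_iff]
  | boxF C ih =>
    simp only [TC.subs, Set.insert_subset_iff] at hC
    have hC' := hC.2 (TC.mem_subs_self _)
    refine iff_of_iff_succ (p := (· ∈ TC.sem M (.boxF C))) (q := (ρ · (.boxF C)))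
      (b := b) (fun n hn => ?_) (fun n hn => ?_) n
    · rw [hr n hn _ hC.1]
      simp only [TC.sem, Set.mem_ofPred_eq, ih hC.2]
      grind
    · obtain ⟨N, hN⟩ := hs n
      grind [TC.mem_sem_boxF_iff]
  | diamP C ih =>
    simp only [TC.subs, Set.insert_subset_iff] at hC
    have hC' := hC.2 (TC.mem_subs_self _)
    refine iff_of_iff_pred (p := (· ∈ TC.sem M (.diamP C))) (q := (ρ · (.diamP C)))
      (a := a) (fun n hn => ?_) (fun n hn => ?_) n
    · rw [hl n hn _ hC.1]
      simp only [TC.sem, Set.mem_ofPred_eq, ih hC.2]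
      grind
    · obtain ⟨N, hN⟩ := hs n
      grind [TC.mem_sem_diamP_iff]
  | boxP C ih =>
    simp only [TC.subs, Set.insert_subset_iff] at hC
    have hC' := hC.2 (TC.mem_subs_self _)
    refine iff_of_iff_pred (p := (· ∈ TC.sem M (.boxP C))) (q := (ρ · (.boxP C)))
      (a := a) (fun n hn => ?_) (fun n hn => ?_) n
    · rw [hl n hn _ hC.1]
      simp only [TC.sem, Set.mem_ofPred_eq, ih hC.2]
      grind
    · obtain ⟨N, hN⟩ := hs n
      grind [TC.mem_sem_boxP_iff]
  | untl C D ihC ihD =>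
    simp only [TC.subs, Set.insert_subset_iff, Set.union_subset_iff] at hC
    have hC' := hC.2.1 (TC.mem_subs_self _)
    have hD' := hC.2.2 (TC.mem_subs_self _)
    refine iff_of_iff_succ (p := (· ∈ TC.sem M (.untl C D))) (q := (ρ · (.untl C D)))
      (b := b) (fun n hn => ?_) (fun n hn => ?_) n
    · rw [hr n hn _ hC.1]
      simp only [TC.sem, Set.mem_ofPred_eq, ihC hC.2.1, ihD hC.2.2]
      grind
    · obtain ⟨N, hN⟩ := hs n
      grind [TC.mem_sem_untl_iff]
  | since C D ihC ihD =>
    simp only [TC.subs, Set.insert_subset_iff, Set.union_subset_iff] at hC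
    have hC' := hC.2.1 (TC.mem_subs_self _)
    have hD' := hC.2.2 (TC.mem_subs_self _)
    refine iff_of_iff_pred (p := (· ∈ TC.sem M (.since C D))) (q := (ρ · (.since C D)))
      (a := a) (fun n hn => ?_) (fun n hn => ?_) n
    · rw [hl n hn _ hC.1]
      simp only [TC.sem, Set.mem_ofPred_eq, ihC hC.2.1, ihD hC.2.2]
      grind
    · obtain ⟨N, hN⟩ := hs n
      grind [TC.mem_sem_since_iff]

/-! ## Building MSO formulas -/

/-- Every Boolean function of finitely many formulas is expressible. -/
theorem Fml.exists_eval_iff_bool (g : ℕ → Fml) (hg : ∀ i, (g i).IsMSO) (V : Set ℕ)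
    (hV : ∀ i, (g i).fvars ⊆ V) (n : ℕ) (R : (ℕ → Prop) → Prop) :
    ∃ ψ : Fml, ψ.IsMSO ∧ ψ.fvars ⊆ V ∧ ∀ D I env senv prev Q,
      Fml.eval D I ψ env senv prev Q ↔
        R fun i => i < n ∧ Fml.eval D I (g i) env senv prev Q := by
  induction n generalizing R with
  | zero =>
    by_cases h : R fun _ => False
    · exact ⟨.neg .falsum, by simp [IsMSO], by simp [fvars], by simp [eval, h]⟩
    · exact ⟨.falsum, by simp [IsMSO], by simp [fvars], by simp [eval, h]⟩
  | succ n ih =>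
    obtain ⟨ψ₀, hm₀, hv₀, he₀⟩ := ih R
    obtain ⟨ψ₁, hm₁, hv₁, he₁⟩ := ih fun v => R fun i => i = n ∨ v i
    refine ⟨.or (.and (g n) ψ₁) (.and (.neg (g n)) ψ₀), ?_, ?_, ?_⟩
    · simp [IsMSO, hg, hm₀, hm₁]
    · simp [fvars, hV, hv₀, hv₁]
    · intro D I env senv prev Q
      simp only [eval, he₀, he₁]
      by_cases h : eval D I (g n) env senv prev Q
      · simp only [h, true_and, not_true_eq_false, false_and, or_false]
        refine iff_of_eq (congrArg R (funext fun i => propext ?_))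
        grind
      · simp only [h, not_false_eq_true, true_and, false_and, false_or]
        refine iff_of_eq (congrArg R (funext fun i => propext ?_))
        grind

/-- Existential quantification over the set variables with index below `n`. -/
def Fml.exSBelow : ℕ → Fml → Fml
  | 0, φ => φ
  | n + 1, φ => Fml.exSBelow n (.exS n φ)

theorem Fml.isMSO_exSBelow {φ : Fml} (h : φ.IsMSO) (n : ℕ) : (φ.exSBelow n).IsMSO := by
  induction n generalizing φ with
  | zero => exact h
  | succ n ih => exact ih (φ := .exS n φ) h

theorem Fml.fvars_exSBelow (φ : Fml) (n : ℕ) : (φ.exSBelow n).fvars = φ.fvars := by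
  induction n generalizing φ with
  | zero => rfl
  | succ n ih => exact ih (.exS n φ)

theorem Fml.eval_exSBelow {D : Set ℤ} {I : ℕ → Set ℤ} (φ : Fml) (n : ℕ) (env : ℕ → ℤ)
    (senv : ℕ → Set ℤ) (prev : ℕ → Prop) (Q : ℕ → ℤ → Prop) :
    Fml.eval D I (φ.exSBelow n) env senv prev Q ↔
      ∃ X : ℕ → Set ℤ, (∀ i < n, X i ⊆ D) ∧ (∀ i, n ≤ i → X i = senv i) ∧
        Fml.eval D I φ env X prev Q := by
  induction n generalizing φ with
  | zero =>
    refine ⟨fun h => ⟨senv, by simp, by simp, h⟩, ?_⟩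
    rintro ⟨X, -, hX, h⟩
    rwa [funext fun i => hX i (Nat.zero_le i)] at h
  | succ n ih =>
    rw [exSBelow, ih]
    constructor
    · rintro ⟨X, hX, hX', Y, hY, h⟩
      refine ⟨_, fun i hi => ?_, fun i hi => ?_, h⟩
      · rcases eq_or_ne i n with rfl | hne
        · simpa using hY
        · simpa [hne] using hX i (by omega)
      · simpa [show i ≠ n by omega] using hX' i (by omega)
    · rintro ⟨X, hX, hX', h⟩
      refine ⟨Function.update X n (senv n), fun i hi => ?_, fun i hi => ?_, X n,
        hX n n.lt_succ_self, by simpa using h⟩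
      · simpa [hi.ne] using hX i (by omega)
      · rcases eq_or_ne i n with rfl | hne
        · simp
        · simpa [hne] using hX' i (by omega)

/-- `y` is the immediate successor of `x`, for the variables `1`, `2` in the roles of `x`, `y`. -/
def Fml.isNext : Fml := .and (.lt 1 2) (.neg (.ex 3 (.and (.lt 1 3) (.lt 3 2))))

/-- Labellings of the domain by set variables below `n` satisfying the condition `ψ` on
consecutive points, the condition `χ` on all points, and the condition `θ`. -/
def Fml.labelling (n : ℕ) (ψ χ θ : Fml) : Fml :=
  Fml.exSBelow n (.and (.and (.all 1 (.all 2 (.or (.neg .isNext) ψ))) (.all 1 χ)) θ)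

theorem Fml.evalIn_labelling {a b : ℤ} {I : Itp} (n : ℕ) (ψ χ θ : Fml) (ℓ : ℤ) :
    Fml.evalIn (Set.Icc a b) I (Fml.labelling n ψ χ θ) (fun _ => ℓ) ↔
      ∃ X : ℕ → Set ℤ, (∀ i < n, X i ⊆ Set.Icc a b) ∧ (∀ i, n ≤ i → X i = ∅) ∧
        (∀ k, a ≤ k → k < b → Fml.eval (Set.Icc a b) I ψ
          (Function.update (Function.update (fun _ => ℓ) 1 k) 2 (k + 1)) X
          (fun _ => False) (fun _ _ => False)) ∧
        (∀ k, a ≤ k → k ≤ b → Fml.eval (Set.Icc a b) I χ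
          (Function.update (fun _ => ℓ) 1 k) X (fun _ => False) (fun _ _ => False)) ∧
        Fml.eval (Set.Icc a b) I θ (fun _ => ℓ) X (fun _ => False) (fun _ _ => False) := by
  simp only [evalIn, labelling, eval_exSBelow, isNext, eval, and_assoc]
  refine exists_congr fun X => and_congr Iff.rfl <| and_congr Iff.rfl <|
    and_congr ⟨fun h k hk hkb => ?_, fun h x hx y hy => ?_⟩ (by simp)
  · refine (h k ⟨hk, by omega⟩ (k + 1) ⟨by omega, by omega⟩).resolve_left ?_
    simp
  · rw [or_iff_not_imp_left, not_not]
    rintro ⟨hxy, hn⟩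
    simp at hxy hn hx hy
    obtain rfl : y = x + 1 := by
      by_contra hne
      have := hn (x + 1) (by omega) (by omega)
      omega
    exact h x hx.1 (by omega)

/-! ## The rewriting -/

/-- `T` and `T'` are, on the concepts of `S`, the types of two consecutive points of a model
of the ontology `O`. -/
def Ontology.Consecutive (O : Ontology) (S : Set TC) (T T' : TC → Prop) : Prop :=
  ∃ M : Itp, (∀ cl ∈ O, cl.holds M) ∧ ∃ k : ℤ,
    ∀ C ∈ S, (T C ↔ k ∈ TC.sem M C) ∧ (T' C ↔ k + 1 ∈ TC.sem M C)

theorem Ontology.consecutive_congr {O : Ontology} {S : Set TC} {T₁ T₂ T₁' T₂' : TC → Prop}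
    (h : ∀ C ∈ S, (T₁ C ↔ T₂ C)) (h' : ∀ C ∈ S, (T₁' C ↔ T₂' C)) :
    O.Consecutive S T₁ T₁' ↔ O.Consecutive S T₂ T₂' :=
  exists_congr fun _ => and_congr Iff.rfl <| exists_congr fun _ => forall₂_congr fun C hC => by
    rw [h C hC, h' C hC]

theorem Ontology.Consecutive.exists_at {O : Ontology} {S : Set TC} {T T' : TC → Prop}
    (h : O.Consecutive S T T') (n : ℤ) :
    ∃ M : Itp, (∀ cl ∈ O, cl.holds M) ∧
      ∀ C ∈ S, (T C ↔ n ∈ TC.sem M C) ∧ (T' C ↔ n + 1 ∈ TC.sem M C) := by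
  obtain ⟨M, hM, k, hk⟩ := h
  refine ⟨M.translate (k - n), fun cl hcl => Clause.holds_translate (hM cl hcl) _, ?_⟩
  intro C hC
  rw [TC.mem_sem_translate, TC.mem_sem_translate, show n + (k - n) = k by ring,
    show n + 1 + (k - n) = k + 1 by ring]
  exact hk C hC

theorem DataInstance.minT_lt_maxT (A : DataInstance) : A.minT < A.maxT := by
  obtain ⟨p, hp, hp0⟩ := A.has_zero
  obtain ⟨q, hq, hq1⟩ := A.has_one
  have h₁ := Finset.min'_le _ _ (Finset.mem_image_of_mem Prod.snd hp)
  have h₂ := Finset.le_max' _ _ (Finset.mem_image_of_mem Prod.snd hq)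
  unfold DataInstance.minT DataInstance.maxT
  omega

theorem DataInstance.mem_tem (A : DataInstance) {p : ℕ × ℤ} (hp : p ∈ A.atoms) :
    p.2 ∈ A.tem :=
  ⟨Finset.min'_le _ _ (Finset.mem_image_of_mem Prod.snd hp),
    Finset.le_max' _ _ (Finset.mem_image_of_mem Prod.snd hp)⟩

/-- A model of `(O, A)` is the same, on the active domain, as a labelling by types whose
consecutive pairs are realised in models of `O` and which contains the data. -/
theorem exists_isModel_iff (O : Ontology) (A : DataInstance) {S : Set TC} (hO : O.subs ⊆ S)
    {κ : TC} (hκ : κ.subs ⊆ S) {ℓ : ℤ} (hℓ : ℓ ∈ A.tem) :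
    (∃ M : Itp, IsModel M O A ∧ ℓ ∉ TC.sem M κ) ↔
      ∃ τ : ℤ → TC → Prop,
        (∀ k, A.minT ≤ k → k < A.maxT → O.Consecutive S (τ k) (τ (k + 1))) ∧
        (∀ p ∈ A.atoms, TC.atom p.1 ∈ S → τ p.2 (.atom p.1)) ∧ ¬ τ ℓ κ := by
  constructor
  · rintro ⟨M, ⟨hM, hA⟩, hκM⟩
    exact ⟨fun n C => n ∈ TC.sem M C, fun k _ _ => ⟨M, hM, k, by simp⟩,
      fun p hp _ => hA p hp, hκM⟩
  · rintro ⟨τ, hτ, hA, hκτ⟩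
    have hlt := A.minT_lt_maxT
    obtain ⟨hℓ₁, hℓ₂⟩ := hℓ
    set a := A.minT
    set b := A.maxT
    obtain ⟨M₁, hM₁, h₁⟩ := (hτ a le_rfl hlt).exists_at a
    obtain ⟨M₂, hM₂, h₂⟩ := (hτ (b - 1) (by omega) (by omega)).exists_at (b - 1)
    simp only [sub_add_cancel] at h₂
    let ρ : ℤ → TC → Prop := fun n C =>
      if n < a then n ∈ TC.sem M₁ C else if b < n then n ∈ TC.sem M₂ C else τ n C
    have hl : ∀ n ≤ a, ∀ C ∈ S, (ρ n C ↔ n ∈ TC.sem M₁ C) := by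
      intro n hn C hC
      rcases hn.lt_or_eq with h | rfl
      · simp [ρ, h]
      · simp [ρ, hlt.le, (h₁ C hC).1]
    have hr : ∀ n, b ≤ n → ∀ C ∈ S, (ρ n C ↔ n ∈ TC.sem M₂ C) := by
      intro n hn C hC
      rcases hn.lt_or_eq with h | rfl
      · simp [ρ, h, (hlt.trans h).le]
      · simp [ρ, hlt.le, (h₂ C hC).2]
    have hm : ∀ n, a ≤ n → n ≤ b → ρ n = τ n := by
      intro n hn hn'
      funext C
      simp only [ρ, if_neg hn.not_gt, if_neg hn'.not_gt]
    have hs : ∀ n, ∃ M : Itp, (∀ cl ∈ O, cl.holds M) ∧ ∀ C ∈ S,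
        (ρ n C ↔ n ∈ TC.sem M C) ∧ (ρ (n + 1) C ↔ n + 1 ∈ TC.sem M C) := by
      intro n
      rcases lt_or_ge n a with hn | hn
      · exact ⟨M₁, hM₁, fun C hC => ⟨hl n hn.le C hC, hl _ (by omega) C hC⟩⟩
      rcases le_or_gt b n with hn' | hn'
      · exact ⟨M₂, hM₂, fun C hC => ⟨hr n hn' C hC, hr _ (by omega) C hC⟩⟩
      rw [hm n hn hn'.le, hm (n + 1) (by omega) (by omega)]
      exact (hτ n hn hn').exists_at n
    have key := TC.mem_sem_glue hl hr fun n => (hs n).imp fun _ h => h.2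
    refine ⟨fun x => {n | TC.atom x ∈ S → ρ n (.atom x)},
      ⟨fun cl hcl n => ?_, fun p hp hpS => ?_⟩, ?_⟩
    · obtain ⟨M, hM, h⟩ := hs n
      have hS : ∀ C, C ∈ cl.prem ∨ C ∈ cl.concl → C.subs ⊆ S := fun C hC =>
        .trans (fun E hE => (⟨cl, hcl, C, hC, hE⟩ : E ∈ O.subs)) hO
      have hiff : ∀ C, C ∈ cl.prem ∨ C ∈ cl.concl →
          (n ∈ TC.sem (fun x => {n | TC.atom x ∈ S → ρ n (.atom x)}) C ↔ n ∈ TC.sem M C) :=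
        fun C hC => (key C (hS C hC) n).trans (h C (hS C hC (TC.mem_subs_self C))).1
      intro hn
      obtain ⟨C, hC, hnC⟩ := hM cl hcl n fun C hC => (hiff C (.inl hC)).1 (hn C hC)
      exact ⟨C, hC, (hiff C (.inr hC)).2 hnC⟩
    · obtain ⟨hp₁, hp₂⟩ := A.mem_tem hp
      rw [hm _ hp₁ hp₂]
      exact hA p hp hpS
    · rw [key κ hκ, hm ℓ hℓ₁ hℓ₂]
      exact hκτ

/-- MSO(<)-rewritability of LTL_bool^□○ OMIQs. -/
theorem boolBoxNext_OMIQ_MSO_rewritable (O : Ontology) (hO : O.BoolBoxNext) (κ : TC) :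
    ∃ φ : Fml, φ.IsMSO ∧ φ.fvars ⊆ {0} ∧
      ∀ A : DataInstance,
        certAns O κ A = {ℓ ∈ A.tem | Fml.evalIn A.tem A.itp φ (fun _ => ℓ)} := by
  set S : Set TC := κ.subs ∪ O.subs
  have hfin : S.Finite := κ.subs_finite.union O.subs_finite
  have hOS : O.subs ⊆ S := Set.subset_union_right
  have hκS : κ.subs ⊆ S := Set.subset_union_left
  obtain ⟨f, hf⟩ := Set.countable_iff_exists_injOn.1 hfin.countable
  obtain ⟨N, hN⟩ : ∃ N, ∀ C ∈ S, f C < N := by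
    obtain ⟨N, hN⟩ := (hfin.image f).bddAbove
    exact ⟨N + 1, fun C hC => Nat.lt_succ_of_le (hN ⟨C, hC, rfl⟩)⟩
  obtain ⟨K, hK⟩ : ∃ K, ∀ x, TC.atom x ∈ S → x < K := by
    obtain ⟨K, hK⟩ := (hfin.preimage (f := TC.atom) fun x _ y _ h => TC.atom.inj h).bddAbove
    exact ⟨K + 1, fun x hx => Nat.lt_succ_of_le (hK hx)⟩
  obtain ⟨ψ, hψm, hψv, hψ⟩ := Fml.exists_eval_iff_bool
    (fun i => .svar (i / 2) (i % 2 + 1)) (fun _ => trivial) {1, 2}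
    (fun i => by have := Nat.mod_two_eq_zero_or_one i; simp [Fml.fvars]; omega) (2 * N)
    (fun v => O.Consecutive S (fun C => v (2 * f C)) (fun C => v (2 * f C + 1)))
  obtain ⟨χ, hχm, hχv, hχ⟩ := Fml.exists_eval_iff_bool
    (fun i => if i % 2 = 0 then .svar (i / 2) 1 else .atom (i / 2) 1)
    (fun i => by split <;> trivial) {1}
    (fun i => by split <;> simp [Fml.fvars]) (2 * (N + K))
    (fun v => ∀ x, TC.atom x ∈ S → v (2 * x + 1) → v (2 * f (.atom x)))
  refine ⟨.neg (.labelling N ψ χ (.neg (.svar (f κ) 0))), ?_, ?_, fun A => ?_⟩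
  · refine Fml.isMSO_exSBelow ?_ N
    simp [Fml.IsMSO, Fml.isNext, hψm, hχm]
  · simp only [Fml.fvars, Fml.labelling, Fml.fvars_exSBelow, Fml.isNext]
    intro x hx
    have h₁ := @hψv x
    have h₂ := @hχv x
    simp at hx h₁ h₂ ⊢
    tauto
  · ext ℓ
    refine and_congr_right fun hℓ => ?_
    have hmain := exists_isModel_iff O A hOS hκS hℓ
    have hlab := Fml.evalIn_labelling (a := A.minT) (b := A.maxT) (I := A.itp) N ψ χ
      (.neg (.svar (f κ) 0)) ℓ
    have hψ' : ∀ (X : ℕ → Set ℤ) (k : ℤ), Fml.eval A.tem A.itp ψ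
        (Function.update (Function.update (fun _ => ℓ) 1 k) 2 (k + 1)) X
          (fun _ => False) (fun _ _ => False) ↔
        O.Consecutive S (fun C => k ∈ X (f C)) (fun C => k + 1 ∈ X (f C)) := by
      intro X k
      rw [hψ]
      refine Ontology.consecutive_congr (fun C hC => ?_) (fun C hC => ?_)
      · have := hN C hC
        simp [Fml.eval, this]
      · have := hN C hC
        have h₁ : (2 * f C + 1) / 2 = f C := by omega
        have h₂ : 2 * f C + 1 < 2 * N := by omega
        simp [Fml.eval, h₁, h₂]
    have hχ' : ∀ (X : ℕ → Set ℤ) (k : ℤ), Fml.eval A.tem A.itp χ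
        (Function.update (fun _ => ℓ) 1 k) X (fun _ => False) (fun _ _ => False) ↔
        ∀ x, TC.atom x ∈ S → (x, k) ∈ A.atoms → k ∈ X (f (.atom x)) := by
      intro X k
      rw [hχ]
      refine forall₂_congr fun x hx => ?_
      have h₁ := hN _ hx
      have h₂ := hK x hx
      have h₃ : (2 * x + 1) / 2 = x := by omega
      have h₄ : 2 * x + 1 < 2 * (N + K) := by omega
      have h₅ : f (.atom x) < N + K := by omega
      simp [Fml.eval, h₃, h₄, h₅, DataInstance.itp]
    rw [Fml.evalIn, Fml.eval, ← not_iff_not, not_not]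
    push Not
    refine hmain.trans (Iff.trans ⟨?_, ?_⟩ hlab.symm)
    · rintro ⟨τ, hτ, hA, hκτ⟩
      have hX : ∀ n ∈ A.tem, ∀ C ∈ S,
          (n ∈ {n | n ∈ A.tem ∧ ∃ C' ∈ S, f C' = f C ∧ τ n C'} ↔ τ n C) := by
        refine fun n hn C hC => ⟨?_, fun h => ⟨hn, C, hC, rfl, h⟩⟩
        rintro ⟨-, C', hC', he, h⟩
        rwa [← hf hC' hC he]
      refine ⟨fun i => {n | n ∈ A.tem ∧ ∃ C' ∈ S, f C' = i ∧ τ n C'}, fun i _ n hn => hn.1,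
        fun i hi => ?_, fun k hk hk' => (hψ' _ k).2 ?_, fun k hk hk' => (hχ' _ k).2 ?_, ?_⟩
      · refine Set.eq_empty_of_forall_notMem ?_
        rintro n ⟨-, C, hC, rfl, -⟩
        exact (hN C hC).not_ge hi
      · exact (Ontology.consecutive_congr (hX k ⟨hk, hk'.le⟩)
          (hX (k + 1) ⟨by omega, by omega⟩)).2 (hτ k hk hk')
      · exact fun x hx hxk => (hX k ⟨hk, hk'⟩ _ hx).2 (hA _ hxk hx)
      · exact fun h => hκτ ((hX ℓ hℓ κ (hκS κ.mem_subs_self)).1 h)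
    · rintro ⟨X, -, -, h₁, h₂, h₃⟩
      exact ⟨fun n C => n ∈ X (f C), fun k hk hk' => (hψ' X k).1 (h₁ k hk hk'),
        fun p hp hpS => (hχ' X p.2).1 (h₂ _ (A.mem_tem hp).1 (A.mem_tem hp).2) _ hpS hp, h₃⟩

end LTLOMQ
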